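/- arXiv:1804.08176 — 8 statements merged into one kernel-verified Lean document; each statement's English description precedes it below -/
import Mathlib

section
/- Let p be a prime, let n, d ≥ 1, and let f : {0,1}^n → {0,1} be computed by a polynomial of degree at most d over 𝔽_p. Then for every ε > 0 and every integer k ≥ 1 with p^{-k} ≤ ε, there exists a torus polynomial of degree at most (2k−1)·d that ε-approximates f. -/
open Finset

noncomputable section

/-- The one-dimensional torus `ℝ/ℤ`. -/
abbrev 𝕋 := AddCircle (1 : ℝ)

/-- Real value of a Boolean input bit. -/
def bval {n : ℕ} (x : Fin n → Bool) (i : Fin n) : ℝ := if x i then 1 else 0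

/-- Hamming weight of a Boolean input. -/
def wt {n : ℕ} (x : Fin n → Bool) : ℕ := ∑ i, if x i then 1 else 0

/-- `P` is a torus polynomial of degree at most `d` in `n` variables. -/
def IsTorusPoly {n : ℕ} (d : ℕ) (P : (Fin n → Bool) → 𝕋) : Prop :=
  ∃ c : Finset (Fin n) → ℝ, (∀ S, d < S.card → c S = 0) ∧
    ∀ x, P x = ((∑ S : Finset (Fin n), c S * ∏ i ∈ S, bval x i : ℝ) : 𝕋)

/-- `P` ε-approximates the Boolean function `f`. -/
def Approx {n : ℕ} (P : (Fin n → Bool) → 𝕋) (f : (Fin n → Bool) → Bool) (ε : ℝ) : Prop :=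
  ∀ x, ‖P x - (((if f x then 1 else 0) / 2 : ℝ) : 𝕋)‖ ≤ ε

/-- The modulus-amplifying polynomial of degree `2k-1`, evaluated at `y`. -/
def amplify {R : Type*} [CommRing R] (k : ℕ) (y : R) : R :=
  ∑ j ∈ Finset.Ico k (2 * k), y ^ j * (1 - y) ^ (2 * k - 1 - j) * ((2 * k - 1).choose j : R)

theorem pow_dvd_amplify {R : Type*} [CommRing R] (k : ℕ) (y : R) : y ^ k ∣ amplify k y := by
  refine Finset.dvd_sum fun j hj => ?_
  exact ((pow_dvd_pow y (Finset.mem_Ico.1 hj).1).mul_right _).mul_right _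

theorem one_sub_pow_dvd_amplify_sub_one {R : Type*} [CommRing R] {k : ℕ} (hk : 1 ≤ k) (y : R) :
    (1 - y) ^ k ∣ amplify k y - 1 := by
  have hsum : ∑ j ∈ Finset.range (2 * k),
      y ^ j * (1 - y) ^ (2 * k - 1 - j) * ((2 * k - 1).choose j : R) = 1 := by
    have h := add_pow y (1 - y) (2 * k - 1)
    rw [show 2 * k - 1 + 1 = 2 * k by omega] at h
    rw [← h]
    simp
  rw [← Finset.sum_range_add_sum_Ico _ (show k ≤ 2 * k by omega)] at hsum
  rw [← amplify, ← eq_sub_iff_add_eq'] at hsum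
  rw [hsum, sub_sub_cancel_left, dvd_neg]
  refine Finset.dvd_sum fun j hj => ?_
  have hj := Finset.mem_range.1 hj
  exact ((pow_dvd_pow (1 - y) (by omega)).mul_left _).mul_right _

theorem map_amplify {R S : Type*} [CommRing R] [CommRing S] (φ : R →+* S) (k : ℕ) (y : R) :
    φ (amplify k y) = amplify k (φ y) := by
  simp [amplify]

theorem totalDegree_amplify_le {σ R : Type*} [CommRing R] (k d : ℕ) (G : MvPolynomial σ R)
    (hG : G.totalDegree ≤ d) : (amplify k G).totalDegree ≤ (2 * k - 1) * d := by
  refine MvPolynomial.totalDegree_finsetSum_le fun j hj => ?_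
  have hj := Finset.mem_Ico.1 hj
  have hsub : (1 - G).totalDegree ≤ d :=
    (MvPolynomial.totalDegree_sub _ _).trans (by simpa using hG)
  have hcast : (((2 * k - 1).choose j : ℕ) : MvPolynomial σ R).totalDegree = 0 := by
    rw [← map_natCast (MvPolynomial.C : R →+* MvPolynomial σ R), MvPolynomial.totalDegree_C]
  calc _ ≤ _ := MvPolynomial.totalDegree_mul _ _
    _ ≤ (G ^ j).totalDegree + ((1 - G) ^ (2 * k - 1 - j)).totalDegree + 0 := by
      rw [hcast]
      exact Nat.add_le_add_right (MvPolynomial.totalDegree_mul _ _) 0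
    _ ≤ j * d + (2 * k - 1 - j) * d := by
      rw [add_zero]
      exact add_le_add
        ((MvPolynomial.totalDegree_pow _ _).trans (Nat.mul_le_mul_left _ hG))
        ((MvPolynomial.totalDegree_pow _ _).trans (Nat.mul_le_mul_left _ hsub))
    _ = (2 * k - 1) * d := by
      rw [← add_mul]
      congr 1
      omega

/-- Polynomials over `ZMod p` lift to integer polynomials of no larger total degree. -/
theorem exists_int_lift {σ : Type*} {p : ℕ} [NeZero p] (F : MvPolynomial σ (ZMod p)) :
    ∃ G : MvPolynomial σ ℤ, MvPolynomial.map (Int.castRingHom (ZMod p)) G = F ∧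
      G.totalDegree ≤ F.totalDegree := by
  refine ⟨∑ m ∈ F.support, MvPolynomial.monomial m ((F.coeff m).val : ℤ), ?_, ?_⟩
  · conv_rhs => rw [F.as_sum]
    simp [MvPolynomial.map_monomial]
  · refine MvPolynomial.totalDegree_finsetSum_le fun m hm => ?_
    exact (MvPolynomial.totalDegree_monomial_le _ _).trans (MvPolynomial.le_totalDegree hm)

/-- On the Boolean cube, a real polynomial reduces to a multilinear one, giving a torus
polynomial. -/
theorem isTorusPoly_eval {n D : ℕ} (H : MvPolynomial (Fin n) ℝ) (hH : H.totalDegree ≤ D) :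
    IsTorusPoly D fun x => ((MvPolynomial.eval (bval x) H : ℝ) : 𝕋) := by
  refine ⟨fun S => ∑ m ∈ H.support with m.support = S, H.coeff m, fun S hS => ?_, fun x => ?_⟩
  · refine Finset.sum_eq_zero fun m hm => ?_
    obtain ⟨hmH, rfl⟩ := Finset.mem_filter.1 hm
    have hcard : m.support.card ≤ m.sum fun _ e => e := by
      rw [Finset.card_eq_sum_ones]
      exact Finset.sum_le_sum fun i hi =>
        Nat.one_le_iff_ne_zero.2 (Finsupp.mem_support_iff.1 hi)
    have := MvPolynomial.le_totalDegree hmH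
    omega
  · refine congrArg _ ?_
    rw [MvPolynomial.eval_eq, ← Finset.sum_fiberwise H.support (fun m => m.support)]
    refine Finset.sum_congr rfl fun S _ => ?_
    rw [Finset.sum_mul]
    refine Finset.sum_congr rfl fun m hm => ?_
    obtain ⟨hm, rfl⟩ := Finset.mem_filter.1 hm
    congr 1
    refine Finset.prod_congr rfl fun i hi => ?_
    have := Finsupp.mem_support_iff.1 hi
    by_cases hx : x i <;> simp [bval, hx, this]

theorem norm_coe_le_abs_sub_int (r : ℝ) (z : ℤ) : ‖(r : 𝕋)‖ ≤ |r - z| :=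
  (UnitAddCircle.norm_eq (x := r)).trans_le (round_le r z)

/-- if a Boolean function is computed by a degree-`d` polynomial over `𝔽_p`,
then for every `ε > 0` and `k ≥ 1` with `p^{-k} ≤ ε` there is a torus polynomial of degree
at most `(2k-1)·d` that ε-approximates it. -/
theorem stmt_0 (p n d : ℕ) (hp : p.Prime) (hn : 1 ≤ n) (hd : 1 ≤ d)
    (f : (Fin n → Bool) → Bool) (F : MvPolynomial (Fin n) (ZMod p))
    (hdeg : F.totalDegree ≤ d)
    (hcomp : ∀ x : Fin n → Bool,
      MvPolynomial.eval (fun i => if x i then (1 : ZMod p) else 0) F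
        = (if f x then 1 else 0))
    (ε : ℝ) (hε : 0 < ε) (k : ℕ) (hk : 1 ≤ k) (hpk : ((p : ℝ) ^ k)⁻¹ ≤ ε) :
    ∃ P : (Fin n → Bool) → 𝕋, IsTorusPoly ((2 * k - 1) * d) P ∧ Approx P f ε := by
  have : NeZero p := ⟨hp.ne_zero⟩
  obtain ⟨G, rfl, hGF⟩ := exists_int_lift F
  have hN : (0 : ℝ) < (p : ℝ) ^ k := pow_pos (Nat.cast_pos.2 hp.pos) k
  set a : ℕ := p ^ k / 2 with ha
  set H : MvPolynomial (Fin n) ℝ :=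
    MvPolynomial.C ((a : ℝ) / (p : ℝ) ^ k) *
      MvPolynomial.map (Int.castRingHom ℝ) (amplify k G) with hH
  have hHdeg : H.totalDegree ≤ (2 * k - 1) * d := by
    refine (MvPolynomial.totalDegree_mul _ _).trans ?_
    rw [MvPolynomial.totalDegree_C, zero_add]
    exact (Finset.sup_mono (MvPolynomial.support_map_subset _ _)).trans
      (totalDegree_amplify_le k d G (hGF.trans hdeg))
  refine ⟨_, isTorusPoly_eval H hHdeg, fun x => ?_⟩
  set b : Fin n → ℤ := fun i => if x i then 1 else 0 with hb
  set y : ℤ := MvPolynomial.eval b G with hy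
  have hbval : bval x = fun i => Int.castRingHom ℝ (b i) := by
    funext i
    by_cases hx : x i <;> simp [bval, hb, hx]
  have heval : MvPolynomial.eval (bval x) H = (a : ℝ) / (p : ℝ) ^ k * (amplify k y : ℤ) := by
    rw [hH, map_mul, MvPolynomial.eval_C, hbval, hy, ← map_amplify]
    congr 1
    exact (MvPolynomial.map_eval (Int.castRingHom ℝ) b (amplify k G)).symm
  have hymod : ((y : ℤ) : ZMod p) = if f x then 1 else 0 := by
    rw [← hcomp x, hy]
    refine (MvPolynomial.map_eval (Int.castRingHom (ZMod p)) b G).trans ?_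
    congr 2
    funext i
    by_cases hx : x i <;> simp [hb, hx]
  change ‖((MvPolynomial.eval (bval x) H : ℝ) : 𝕋) - _‖ ≤ ε
  rw [heval, ← AddCircle.coe_sub]
  by_cases hfx : f x
  · have hdvd : (p : ℤ) ∣ 1 - y := by
      rw [← ZMod.intCast_zmod_eq_zero_iff_dvd]
      simp [hymod, hfx]
    obtain ⟨q, hq⟩ := (pow_dvd_pow_of_dvd hdvd k).trans (one_sub_pow_dvd_amplify_sub_one hk y)
    have hq' : ((amplify k y : ℤ) : ℝ) = 1 + (p : ℝ) ^ k * q := by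
      rw [eq_add_of_sub_eq' hq]
      push_cast
      ring
    refine (norm_coe_le_abs_sub_int _ (a * q)).trans (le_trans ?_ hpk)
    have h1 : 2 * (a : ℝ) ≤ (p : ℝ) ^ k := by
      exact_mod_cast (show 2 * a ≤ p ^ k by omega)
    have h2 : (p : ℝ) ^ k ≤ 2 * a + 1 := by
      exact_mod_cast (show p ^ k ≤ 2 * a + 1 by omega)
    have hr : (a : ℝ) / (p : ℝ) ^ k * (amplify k y : ℤ) - (if f x then 1 else 0) / 2
        - ((a * q : ℤ) : ℝ) = (2 * a - (p : ℝ) ^ k) / 2 * ((p : ℝ) ^ k)⁻¹ := by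
      rw [hq']
      simp only [hfx, if_true]
      push_cast
      field_simp
      ring
    rw [hr, abs_mul, abs_of_pos (inv_pos.2 hN)]
    refine mul_le_of_le_one_left (inv_pos.2 hN).le (abs_le.2 ⟨?_, ?_⟩) <;> linarith
  · have hdvd : (p : ℤ) ∣ y := by
      rw [← ZMod.intCast_zmod_eq_zero_iff_dvd]
      simp [hymod, hfx]
    obtain ⟨q, hq⟩ := (pow_dvd_pow_of_dvd hdvd k).trans (pow_dvd_amplify k y)
    refine (norm_coe_le_abs_sub_int _ (a * q)).trans (le_trans (le_of_eq ?_) hε.le)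
    rw [hq, abs_eq_zero]
    simp only [hfx]
    push_cast
    field_simp
    simp
end
end

section
/- Let P be a torus polynomial of degree at most d in n variables, let ε > 0, and let t ≥ 0 be an integer such that N·2^{-(t+1)} ≤ ε, where N is the number of subsets S ⊆ [n] with 1 ≤ |S| ≤ d. Then there exists a nonclassical polynomial Q of degree at most d + t such that |P(x) − Q(x)| ≤ ε for all x ∈ {0,1}^n. -/
open Finset

noncomputable section

/-- `Q` is a nonclassical polynomial (over `𝔽_2`) of degree at most `D` in `n` variables:
`Q(x) = α + ∑_{(S,k) : S ≠ ∅, |S|+k ≤ D} (c_{S,k}/2^{k+1}) ∏_{i ∈ S} x_i (mod 1)`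
with `c_{S,k} ∈ {0,1}`. -/
def IsNonclassicalPoly {n : ℕ} (D : ℕ) (Q : (Fin n → Bool) → 𝕋) : Prop :=
  ∃ (α : 𝕋) (c : Finset (Fin n) → ℕ → ℕ),
    (∀ S k, c S k ≤ 1) ∧
    (∀ S k, (S = ∅ ∨ D < S.card + k) → c S k = 0) ∧
    ∀ x, Q x = α + ((∑ S : Finset (Fin n), ∑ k ∈ Finset.range (D + 1),
      (c S k : ℝ) / 2 ^ (k + 1) * ∏ i ∈ S, bval x i : ℝ) : 𝕋)

/-- The `k`-th digit after the binary point of a real number. -/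
def binaryDigit (r : ℝ) (k : ℕ) : ℕ := (⌊2 ^ (k + 1) * r⌋ - 2 * ⌊2 ^ k * r⌋).toNat

lemma two_mul_floor_le (r : ℝ) (k : ℕ) : 2 * ⌊2 ^ k * r⌋ ≤ ⌊2 ^ (k + 1) * r⌋ := by
  have h := Int.floor_le (2 ^ k * r)
  rw [Int.le_floor]
  push_cast
  rw [pow_succ]
  linarith

lemma binaryDigit_le_one (r : ℝ) (k : ℕ) : binaryDigit r k ≤ 1 := by
  have h := Int.lt_floor_add_one (2 ^ k * r)
  have h2 : ⌊2 ^ (k + 1) * r⌋ < 2 * ⌊2 ^ k * r⌋ + 2 := by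
    rw [Int.floor_lt]
    push_cast
    rw [pow_succ]
    linarith
  unfold binaryDigit
  omega

lemma cast_binaryDigit (r : ℝ) (k : ℕ) :
    (binaryDigit r k : ℝ) = ⌊2 ^ (k + 1) * r⌋ - 2 * ⌊2 ^ k * r⌋ := by
  have h := Int.toNat_of_nonneg (sub_nonneg.2 (two_mul_floor_le r k))
  have h' := congrArg (Int.cast : ℤ → ℝ) h
  push_cast at h'
  exact h'

lemma sum_binaryDigit (r : ℝ) (m : ℕ) :
    ∑ k ∈ range m, (binaryDigit r k : ℝ) / 2 ^ (k + 1) = ⌊2 ^ m * r⌋ / 2 ^ m - ⌊r⌋ := by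
  induction m with
  | zero => simp
  | succ m ih =>
    rw [sum_range_succ, ih, cast_binaryDigit, pow_succ]
    field_simp
    ring

lemma norm_coe_sub_sum_binaryDigit_le (r : ℝ) (m : ℕ) :
    ‖((r - ∑ k ∈ range m, (binaryDigit r k : ℝ) / 2 ^ (k + 1) : ℝ) : 𝕋)‖ ≤ (2 : ℝ)⁻¹ ^ m := by
  have hpos : (0 : ℝ) < 2 ^ m := by positivity
  have h1 := Int.floor_le (2 ^ m * r)
  have h2 := Int.lt_floor_add_one (2 ^ m * r)
  have hcoe : ((r - ∑ k ∈ range m, (binaryDigit r k : ℝ) / 2 ^ (k + 1) : ℝ) : 𝕋)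
      = ((r - ⌊2 ^ m * r⌋ / 2 ^ m : ℝ) : 𝕋) := by
    rw [sum_binaryDigit, ← sub_add, AddCircle.coe_add, add_eq_left]
    exact (AddCircle.coe_eq_zero_iff 1).2 ⟨⌊r⌋, by simp⟩
  rw [hcoe]
  refine (QuotientAddGroup.norm_mk_le_norm).trans ?_
  have h3 : r - ⌊2 ^ m * r⌋ / 2 ^ m = (2 ^ m * r - ⌊2 ^ m * r⌋) * (2 : ℝ)⁻¹ ^ m := by
    rw [inv_pow]
    field_simp
  rw [h3, Real.norm_eq_abs, abs_mul, abs_of_nonneg (sub_nonneg.2 h1),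
    abs_of_nonneg (by positivity)]
  exact mul_le_of_le_one_left (by positivity) (by linarith)

lemma prod_bval_eq_zero_or_one {n : ℕ} (x : Fin n → Bool) (S : Finset (Fin n)) :
    ∏ i ∈ S, bval x i = 0 ∨ ∏ i ∈ S, bval x i = 1 := by
  by_cases h : ∀ i ∈ S, x i = true
  · exact Or.inr (prod_eq_one fun i hi => by simp [bval, h i hi])
  · push Not at h
    obtain ⟨i, hi, hx⟩ := h
    exact Or.inl (prod_eq_zero hi (by simp [bval, hx]))

/-- any torus polynomial of degree ≤ d is ε-approximated pointwise by a
nonclassical polynomial of degree ≤ d + t, provided `N·2^{-(t+1)} ≤ ε` where `N` is the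
number of subsets `S ⊆ [n]` with `1 ≤ |S| ≤ d`. -/
theorem stmt_4 (n d t : ℕ) (P : (Fin n → Bool) → 𝕋) (hP : IsTorusPoly d P)
    (ε : ℝ) (hε : 0 < ε)
    (hN : (((univ : Finset (Finset (Fin n))).filter
        (fun S => 1 ≤ S.card ∧ S.card ≤ d)).card : ℝ) * (2 : ℝ)⁻¹ ^ (t + 1) ≤ ε) :
    ∃ Q : (Fin n → Bool) → 𝕋, IsNonclassicalPoly (d + t) Q ∧ ∀ x, ‖P x - Q x‖ ≤ ε := by
  obtain ⟨c, hc, hPc⟩ := hP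
  let b : Finset (Fin n) → ℕ → ℕ := fun S k =>
    if (1 ≤ S.card ∧ S.card ≤ d) ∧ k < t + 1 then binaryDigit (c S) k else 0
  refine ⟨_, ⟨(c ∅ : 𝕋), b, ?_, ?_, fun x => rfl⟩, fun x => ?_⟩
  · intro S k
    simp only [b]
    split_ifs
    exacts [binaryDigit_le_one _ _, zero_le_one]
  · intro S k h
    refine if_neg ?_
    rintro ⟨⟨h1, h2⟩, h3⟩
    rcases h with rfl | h
    · simp at h1
    · omega
  · have hsum (S : Finset (Fin n)) : ∑ k ∈ range (d + t + 1), (b S k : ℝ) / 2 ^ (k + 1)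
        = if 1 ≤ S.card ∧ S.card ≤ d then
            ∑ k ∈ range (t + 1), (binaryDigit (c S) k : ℝ) / 2 ^ (k + 1) else 0 := by
      split_ifs with h
      · rw [← sum_subset (range_mono (by omega : t + 1 ≤ d + t + 1))]
        · refine sum_congr rfl fun k hk => ?_
          simp only [b, if_pos (⟨h, mem_range.1 hk⟩ : _ ∧ _)]
        · intro k _ hk
          rw [mem_range] at hk
          simp only [b, hk, and_false, if_false, Nat.cast_zero, zero_div]
      · simp only [b, h, false_and, if_false, Nat.cast_zero, zero_div, sum_const_zero]
    have hdiff : P x - ((c ∅ : 𝕋) + ((∑ S : Finset (Fin n), ∑ k ∈ range (d + t + 1),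
        (b S k : ℝ) / 2 ^ (k + 1) * ∏ i ∈ S, bval x i : ℝ) : 𝕋))
        = ∑ S with 1 ≤ S.card ∧ S.card ≤ d,
          (((c S - ∑ k ∈ range (t + 1), (binaryDigit (c S) k : ℝ) / 2 ^ (k + 1))
            * ∏ i ∈ S, bval x i : ℝ) : 𝕋) := by
      have hreal : ∑ S : Finset (Fin n), c S * ∏ i ∈ S, bval x i
          - (c ∅ + ∑ S : Finset (Fin n), ∑ k ∈ range (d + t + 1),
            (b S k : ℝ) / 2 ^ (k + 1) * ∏ i ∈ S, bval x i)
          = ∑ S with 1 ≤ S.card ∧ S.card ≤ d,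
            (c S - ∑ k ∈ range (t + 1), (binaryDigit (c S) k : ℝ) / 2 ^ (k + 1))
              * ∏ i ∈ S, bval x i := by
        have hempty : c ∅ = ∑ S : Finset (Fin n), if S = ∅ then c S else 0 := by simp
        rw [hempty, ← sum_add_distrib, ← sum_sub_distrib, sum_filter]
        refine sum_congr rfl fun S _ => ?_
        rw [← sum_mul, hsum]
        split_ifs with h1 h2 h2
        · simp [h1] at h2
        · simp [h1]
        · ring
        · have : d < S.card := by
            have := card_pos.2 (nonempty_iff_ne_empty.2 h1)
            omega
          simp [hc S this]
      rw [hPc, ← AddCircle.coe_add, ← AddCircle.coe_sub, hreal]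
      exact map_sum (QuotientAddGroup.mk' _) _ _
    rw [hdiff]
    refine (norm_sum_le_of_le (n := fun _ => (2 : ℝ)⁻¹ ^ (t + 1)) _ fun S _ => ?_).trans ?_
    · rcases prod_bval_eq_zero_or_one x S with h | h
      · rw [h, mul_zero, AddCircle.coe_zero, norm_zero]
        positivity
      · rw [h, mul_one]
        exact norm_coe_sub_sum_binaryDigit_le _ _
    · rwa [sum_const, nsmul_eq_mul]
end
end

section
/- There exists a constant c > 0 such that for all integers n ≥ 2 and d ≥ 1 the following holds: if for every integer w with 0 ≤ w ≤ n there exists a symmetric torus polynomial of degree at most d in n variables that (1/(20n))-approximates Δ_w, then d ≥ c·√(n/log n). -/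
open Finset

noncomputable section

/-- \`P\` is a symmetric torus polynomial of degree at most \`d\` in \`n\` variables:
\`P(x) = ∑_{j=0}^d c_j (x_1 + ⋯ + x_n)^j (mod 1)\`. -/
def IsSymTorusPoly {n : ℕ} (d : ℕ) (P : (Fin n → Bool) → 𝕋) : Prop :=
  ∃ c : ℕ → ℝ, ∀ x, P x = ((∑ j ∈ Finset.range (d + 1), c j * (wt x : ℝ) ^ j : ℝ) : 𝕋)

/-- The delta function \`Δ_w\`: value 1 exactly on inputs of Hamming weight \`w\`. -/
def delta {n : ℕ} (w : ℕ) (x : Fin n → Bool) : Bool := decide (wt x = w)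

/-- MAJORITY on \`m\` bits: value 1 exactly on inputs of Hamming weight at least \`m/2\`. -/
def maj {m : ℕ} (x : Fin m → Bool) : Bool := decide (m ≤ 2 * wt x)

lemma AddCircle.norm_coe_le_abs (r : ℝ) : ‖(r : 𝕋)‖ ≤ |r| := by
  rw [UnitAddCircle.norm_eq]
  simpa using round_le r 0

lemma AddCircle.norm_coe_half : ‖((1 / 2 : ℝ) : 𝕋)‖ = 1 / 2 := by
  rw [(AddCircle.norm_coe_eq_abs_iff (1 : ℝ) one_ne_zero).2] <;> norm_num [abs_of_pos]

lemma exists_wt_eq {n k : ℕ} (hk : k ≤ n) : ∃ x : Fin n → Bool, wt x = k := by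
  obtain ⟨s, -, hs⟩ := Finset.exists_subset_card_eq (s := (univ : Finset (Fin n))) (n := k)
    (by simpa using hk)
  exact ⟨fun i => decide (i ∈ s), by simp [wt, hs]⟩

/-- Reducing the coefficients modulo one does not change the values of a polynomial at natural
numbers modulo one. -/
lemma coe_sum_fract_mul_pow (m k : ℕ) (a : ℕ → ℝ) :
    ((∑ j ∈ range m, Int.fract (a j) * (k : ℝ) ^ j : ℝ) : 𝕋) =
      ((∑ j ∈ range m, a j * (k : ℝ) ^ j : ℝ) : 𝕋) := by
  rw [← sub_eq_zero, ← AddCircle.coe_sub, AddCircle.coe_eq_zero_iff]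
  refine ⟨-∑ j ∈ range m, ⌊a j⌋ * (k : ℤ) ^ j, ?_⟩
  rw [← Finset.sum_sub_distrib, zsmul_eq_mul, mul_one]
  push_cast
  rw [← Finset.sum_neg_distrib]
  refine Finset.sum_congr rfl fun j _ => ?_
  rw [Int.fract]
  ring

/-- If the fractional parts of the coefficients of two polynomials lie in the same cells of a grid
of mesh `1 / N`, then the polynomials are close modulo one at natural numbers up to `n`. -/
lemma norm_sub_le_of_floor_fract_eq {n d k N : ℕ} (hn : 1 ≤ n) (hk : k ≤ n) (hN : 0 < N)
    (a b : ℕ → ℝ)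
    (h : ∀ j ∈ range (d + 1), ⌊(N : ℝ) * Int.fract (a j)⌋₊ = ⌊(N : ℝ) * Int.fract (b j)⌋₊) :
    ‖((∑ j ∈ range (d + 1), a j * (k : ℝ) ^ j : ℝ) : 𝕋) -
      ((∑ j ∈ range (d + 1), b j * (k : ℝ) ^ j : ℝ) : 𝕋)‖ ≤ (d + 1) * (n : ℝ) ^ d / N := by
  rw [← coe_sum_fract_mul_pow, ← coe_sum_fract_mul_pow _ _ b, ← AddCircle.coe_sub]
  refine (AddCircle.norm_coe_le_abs _).trans ?_
  rw [← Finset.sum_sub_distrib]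
  have hN' : (0 : ℝ) < N := by exact_mod_cast hN
  calc |∑ j ∈ range (d + 1),
          (Int.fract (a j) * (k : ℝ) ^ j - Int.fract (b j) * (k : ℝ) ^ j)|
      ≤ ∑ j ∈ range (d + 1), |Int.fract (a j) * (k : ℝ) ^ j - Int.fract (b j) * (k : ℝ) ^ j| :=
        Finset.abs_sum_le_sum_abs _ _
    _ ≤ ∑ j ∈ range (d + 1), (1 / N : ℝ) * (n : ℝ) ^ d := by
        refine Finset.sum_le_sum fun j hj => ?_
        have hfa := Nat.floor_le (mul_nonneg hN'.le (Int.fract_nonneg (a j)))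
        have hfb := Nat.floor_le (mul_nonneg hN'.le (Int.fract_nonneg (b j)))
        have hla := Nat.lt_floor_add_one ((N : ℝ) * Int.fract (a j))
        have hlb := Nat.lt_floor_add_one ((N : ℝ) * Int.fract (b j))
        rw [h j hj] at hfa hla
        have hab : |Int.fract (a j) - Int.fract (b j)| ≤ 1 / N := by
          rw [abs_sub_le_iff, le_div_iff₀ hN', le_div_iff₀ hN']
          constructor <;> linarith
        have hpow : (k : ℝ) ^ j ≤ (n : ℝ) ^ d :=
          (pow_le_pow_left₀ (by positivity) (by exact_mod_cast hk) j).trans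
            (pow_le_pow_right₀ (by exact_mod_cast hn) (by simpa [Nat.lt_succ_iff] using hj))
        rw [← sub_mul, abs_mul, abs_of_nonneg (by positivity : (0 : ℝ) ≤ (k : ℝ) ^ j)]
        gcongr
    _ = (d + 1) * (n : ℝ) ^ d / N := by
        rw [Finset.sum_const, card_range, nsmul_eq_mul]
        push_cast
        ring

/-- Summing approximations of delta functions approximates the indicator of a set of weights. -/
lemma norm_sum_sub_indicator_le {n d k : ℕ} (hn : 2 ≤ n) (c : ℕ → ℕ → ℝ)
    (hc : ∀ w ≤ n, ‖((∑ j ∈ range (d + 1), c w j * (k : ℝ) ^ j : ℝ) : 𝕋) -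
      (((if k = w then 1 else 0) / 2 : ℝ) : 𝕋)‖ ≤ 1 / (20 * n))
    {A : Finset ℕ} (hA : A ⊆ range (n + 1)) :
    ‖((∑ j ∈ range (d + 1), (∑ w ∈ A, c w j) * (k : ℝ) ^ j : ℝ) : 𝕋) -
      (((if k ∈ A then 1 else 0) / 2 : ℝ) : 𝕋)‖ ≤ 3 / 40 := by
  have hsum : (∑ j ∈ range (d + 1), (∑ w ∈ A, c w j) * (k : ℝ) ^ j) =
      ∑ w ∈ A, ∑ j ∈ range (d + 1), c w j * (k : ℝ) ^ j := by
    rw [Finset.sum_comm]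
    exact Finset.sum_congr rfl fun j _ => Finset.sum_mul _ _ _
  have hind : ((if k ∈ A then 1 else 0) / 2 : ℝ) = ∑ w ∈ A, (if k = w then 1 else 0) / 2 := by
    rw [← Finset.sum_div, Finset.sum_ite_eq]
  have hcoe : ∀ f : ℕ → ℝ, ((∑ w ∈ A, f w : ℝ) : 𝕋) = ∑ w ∈ A, (f w : 𝕋) :=
    fun f => map_sum (QuotientAddGroup.mk' (AddSubgroup.zmultiples (1 : ℝ))) f A
  rw [hsum, hind, hcoe, hcoe, ← Finset.sum_sub_distrib]
  have hcard : (A.card : ℝ) ≤ n + 1 := by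
    exact_mod_cast (Finset.card_le_card hA).trans_eq (card_range _)
  have hn' : (2 : ℝ) ≤ n := by exact_mod_cast hn
  calc _ ≤ ∑ w ∈ A, (1 / (20 * n) : ℝ) :=
        norm_sum_le_of_le _ fun w hw => hc w (Nat.lt_succ_iff.1 (mem_range.1 (hA hw)))
    _ = A.card / (20 * n) := by rw [Finset.sum_const, nsmul_eq_mul]; ring
    _ ≤ 3 / 40 := by
        rw [div_le_iff₀ (by positivity)]
        linarith

/-- The number of symmetric Boolean functions is at most the number of cells in a grid of
coefficient vectors. -/
lemma two_pow_le_of_approx_delta {n d : ℕ} (hn : 2 ≤ n)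
    (h : ∀ w : ℕ, w ≤ n → ∃ P : (Fin n → Bool) → 𝕋,
      IsSymTorusPoly d P ∧ Approx P (delta w) (1 / (20 * n))) :
    2 ^ (n + 1) ≤ (3 * (d + 1) * n ^ d) ^ (d + 1) := by
  have hcoeff : ∀ w, ∃ c : ℕ → ℝ, w ≤ n → ∀ k ≤ n,
      ‖((∑ j ∈ range (d + 1), c j * (k : ℝ) ^ j : ℝ) : 𝕋) -
        (((if k = w then 1 else 0) / 2 : ℝ) : 𝕋)‖ ≤ 1 / (20 * n) := by
    intro w
    by_cases hw : w ≤ n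
    · obtain ⟨P, ⟨c, hc⟩, hP⟩ := h w hw
      refine ⟨c, fun _ k hk => ?_⟩
      obtain ⟨x, rfl⟩ := exists_wt_eq hk
      simpa only [hc, delta, decide_eq_true_eq] using hP x
    · exact ⟨0, fun hw' => absurd hw' hw⟩
  choose c hc using hcoeff
  set N := 3 * (d + 1) * n ^ d with hNdef
  have hN : 0 < N := by positivity
  have hN' : (0 : ℝ) < N := by exact_mod_cast hN
  by_contra! hlt
  let cell : Finset ℕ → Fin (d + 1) → Fin N := fun A j =>
    ⟨⌊(N : ℝ) * Int.fract (∑ w ∈ A, c w j)⌋₊, by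
      rw [Nat.floor_lt (mul_nonneg hN'.le (Int.fract_nonneg _))]
      exact mul_lt_of_lt_one_right hN' (Int.fract_lt_one _)⟩
  obtain ⟨A, hA, B, hB, hne, hcell⟩ := Finset.exists_ne_map_eq_of_card_lt_of_maps_to
    (s := (range (n + 1)).powerset) (t := (univ : Finset (Fin (d + 1) → Fin N))) (f := cell)
    (by simpa using hlt) (fun _ _ => by simp)
  rw [mem_powerset] at hA hB
  obtain ⟨k, hk⟩ : ∃ k, ¬(k ∈ A ↔ k ∈ B) := by
    by_contra! hAB
    exact hne (Finset.ext hAB)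
  have hkn : k ≤ n := by
    have : k ∈ range (n + 1) := by
      by_cases hkA : k ∈ A
      · exact hA hkA
      · exact hB (by tauto)
    exact Nat.lt_succ_iff.1 (mem_range.1 this)
  have happA := norm_sum_sub_indicator_le hn c (fun w hw => hc w hw k hkn) hA
  have happB := norm_sum_sub_indicator_le hn c (fun w hw => hc w hw k hkn) hB
  have hclose := norm_sub_le_of_floor_fract_eq (d := d) (by omega : 1 ≤ n) hkn hN
    (fun j => ∑ w ∈ A, c w j) (fun j => ∑ w ∈ B, c w j)
    (fun j hj => congrArg Fin.val (congrFun hcell ⟨j, mem_range.1 hj⟩))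
  have hmesh : (d + 1) * (n : ℝ) ^ d / N = 1 / 3 := by
    rw [div_eq_div_iff hN'.ne' (by norm_num), hNdef]
    push_cast
    ring
  rw [hmesh] at hclose
  generalize ((∑ j ∈ range (d + 1), (∑ w ∈ A, c w j) * (k : ℝ) ^ j : ℝ) : 𝕋) = u at *
  generalize ((∑ j ∈ range (d + 1), (∑ w ∈ B, c w j) * (k : ℝ) ^ j : ℝ) : 𝕋) = v at *
  have hhalf : ‖(((if k ∈ A then 1 else 0) / 2 : ℝ) : 𝕋) -
      (((if k ∈ B then 1 else 0) / 2 : ℝ) : 𝕋)‖ = 1 / 2 := by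
    by_cases hkA : k ∈ A
    · have hkB : k ∉ B := by tauto
      simpa [hkA, hkB] using AddCircle.norm_coe_half
    · have hkB : k ∈ B := by tauto
      simpa [hkA, hkB] using AddCircle.norm_coe_half
  generalize (((if k ∈ A then 1 else 0) / 2 : ℝ) : 𝕋) = p at *
  generalize (((if k ∈ B then 1 else 0) / 2 : ℝ) : 𝕋) = q at *
  have htri : ‖p - q‖ ≤ ‖u - p‖ + ‖u - v‖ + ‖v - q‖ := by
    rw [show p - q = -(u - p) + (u - v) + (v - q) by abel, ← norm_neg (u - p)]
    exact norm_add₃_le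
  linarith

lemma grid_card_le {n d : ℕ} (hn : 2 ≤ n) (hd : 1 ≤ d) :
    (3 * (d + 1) * n ^ d) ^ (d + 1) ≤ n ^ (8 * d ^ 2) := by
  have h3 : 3 ≤ n ^ 2 := by nlinarith
  have hd1 : d + 1 ≤ n ^ d := Nat.lt_pow_self hn
  calc (3 * (d + 1) * n ^ d) ^ (d + 1) ≤ (n ^ 2 * n ^ d * n ^ d) ^ (d + 1) := by gcongr
    _ = n ^ ((2 + d + d) * (d + 1)) := by rw [← pow_add, ← pow_add, ← pow_mul]
    _ ≤ n ^ (8 * d ^ 2) := Nat.pow_le_pow_right (by omega) (by nlinarith)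

/-- if every delta function `Δ_w` on `n` variables is `1/(20n)`-approximated
by a symmetric torus polynomial of degree at most `d`, then `d ≥ c·√(n/log n)`. -/
theorem stmt_5 : ∃ c : ℝ, 0 < c ∧ ∀ n d : ℕ, 2 ≤ n → 1 ≤ d →
    (∀ w : ℕ, w ≤ n → ∃ P : (Fin n → Bool) → 𝕋,
      IsSymTorusPoly d P ∧ Approx P (delta w) (1 / (20 * n))) →
    c * Real.sqrt ((n : ℝ) / Real.log n) ≤ d := by
  refine ⟨1 / 4, by norm_num, fun n d hn hd h => ?_⟩
  have hcount : (2 : ℝ) ^ (n + 1) ≤ (n : ℝ) ^ (8 * d ^ 2) := by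
    exact_mod_cast (two_pow_le_of_approx_delta hn h).trans (grid_card_le hn hd)
  have hlog := Real.log_le_log (by positivity) hcount
  rw [Real.log_pow, Real.log_pow] at hlog
  push_cast at hlog
  have hlogn : 0 < Real.log n := Real.log_pos (by exact_mod_cast hn)
  have hsqrt : Real.sqrt ((n : ℝ) / Real.log n) ≤ 4 * d := by
    rw [Real.sqrt_le_left (by positivity), div_le_iff₀ hlogn]
    have hlog2 := Real.log_two_gt_d9
    nlinarith [(Nat.cast_nonneg n : (0 : ℝ) ≤ n)]
  linarith
end
end

section
/- There exists a constant c > 0 such that for every integer n ≥ 2 the following holds: any symmetric torus polynomial of degree at most d in n variables that (1/(20n))-approximates Maj_n must satisfy d ≥ c·√(n/log n). -/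
open Finset

noncomputable section

open Polynomial in
/-- Moment pigeonhole: a nonzero vector with entries in `{-1, 0, 1}`, supported on `{0, …, t}` with
`t < N` and nonzero at `t`, that annihilates all polynomials of degree at most `d`. -/
lemma exists_sign_vector_annihilating (N d : ℕ) (hN : 2 ≤ N)
    (h : (N ^ (d + 2)) ^ (d + 1) < 2 ^ N) :
    ∃ (a : ℕ → ℤ) (t : ℕ), t < N ∧ (∀ k, |a k| ≤ 1) ∧ Odd (a t) ∧
      ∀ p : ℝ[X], p.natDegree ≤ d → ∑ k ∈ range (t + 1), (a k : ℝ) * p.eval (k : ℝ) = 0 := by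
  classical
  obtain ⟨S, hS, T, hT, hne, heq⟩ := Finset.exists_ne_map_eq_of_card_lt_of_maps_to
    (s := (range N).powerset) (t := Fintype.piFinset fun _ : Fin (d + 1) => range (N ^ (d + 2)))
    (f := fun S j => ∑ k ∈ S, k ^ (j : ℕ)) (by simpa using h) (by
      intro S hS
      have hS' : S ⊆ range N := mem_powerset.1 hS
      simp only [Finset.mem_coe, Fintype.mem_piFinset, mem_range]
      intro j
      calc ∑ k ∈ S, k ^ (j : ℕ) ≤ ∑ k ∈ range N, k ^ (j : ℕ) := sum_le_sum_of_subset hS'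
        _ ≤ ∑ _k ∈ range N, N ^ d := by
          refine sum_le_sum fun k hk => ?_
          have hk := mem_range.1 hk
          calc k ^ (j : ℕ) ≤ N ^ (j : ℕ) := Nat.pow_le_pow_left hk.le _
            _ ≤ N ^ d := Nat.pow_le_pow_right (by omega) (by omega)
        _ = N ^ (d + 1) := by simp [pow_succ, mul_comm]
        _ < N ^ (d + 2) := Nat.pow_lt_pow_right (by omega) (by omega))
  have hS : S ⊆ range N := by simpa using hS
  have hT : T ⊆ range N := by simpa using hT
  have hU : (symmDiff S T).Nonempty := by
    rw [Finset.nonempty_iff_ne_empty]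
    exact fun h0 => hne (symmDiff_eq_bot.1 h0)
  set t := (symmDiff S T).max' hU with ht
  have htmem := (symmDiff S T).max'_mem hU
  rw [← ht] at htmem
  have htN : t < N := by
    rcases Finset.mem_symmDiff.1 htmem with h | h
    · exact mem_range.1 (hS h.1)
    · exact mem_range.1 (hT h.1)
  have hgt : ∀ k, t < k → (k ∈ S ↔ k ∈ T) := by
    intro k hk
    by_contra hc
    have : k ∈ symmDiff S T := by rw [Finset.mem_symmDiff]; tauto
    exact absurd (Finset.le_max' _ _ this) (by omega)
  refine ⟨fun k => (if k ∈ S then 1 else 0) - (if k ∈ T then 1 else 0), t, htN, ?_, ?_, ?_⟩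
  · intro k
    dsimp only
    split_ifs <;> simp
  · rcases Finset.mem_symmDiff.1 htmem with h | h <;> simp [h.1, h.2]
  · intro p hp
    have hext : ∀ g : ℕ → ℝ, ∑ k ∈ range (t + 1),
        (((if k ∈ S then 1 else 0) - (if k ∈ T then 1 else 0) : ℤ) : ℝ) * g k =
        ∑ k ∈ S, g k - ∑ k ∈ T, g k := by
      intro g
      rw [Finset.sum_subset (s₂ := range N)]
      · push_cast
        simp only [sub_mul, sum_sub_distrib, ite_mul, one_mul, zero_mul, ← Finset.sum_filter]
        congr 2
        · ext k; simpa using fun h => mem_range.1 (hS h)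
        · ext k; simpa using fun h => mem_range.1 (hT h)
      · intro k hk
        simp only [mem_range] at *
        omega
      · intro k _ hk
        have := hgt k (by simpa using hk)
        simp [this]
    rw [hext fun k => p.eval (k : ℝ)]
    simp only [Polynomial.eval_eq_sum_range' (Nat.lt_succ_of_le hp)]
    rw [sum_comm, sum_comm (s := T), ← sum_sub_distrib]
    refine sum_eq_zero fun j hj => ?_
    have hj' := congrFun heq ⟨j, mem_range.1 hj⟩
    dsimp only at hj'
    rw [← mul_sum, ← mul_sum, sub_eq_zero]
    congr 1
    exact_mod_cast hj'

open Polynomial in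
/-- A polynomial that is close to integers below a threshold `m` and close to a half-integer at `m`
is not annihilated by a short sign vector ending at `m`. -/
lemma false_of_annihilating {p : ℝ[X]} {m t : ℕ} {ε : ℝ} (htm : t ≤ m)
    (a : ℕ → ℤ) (ha : ∀ k, |a k| ≤ 1) (hodd : Odd (a t))
    (hann : ∀ q : ℝ[X], q.natDegree ≤ p.natDegree →
      ∑ k ∈ range (t + 1), (a k : ℝ) * q.eval (k : ℝ) = 0)
    (hε : 2 * (m + 1) * ε < 1)
    (happ : ∀ k ≤ m, ∃ z : ℤ, |p.eval (k : ℝ) - (if m ≤ k then 1 else 0) / 2 - z| ≤ ε) :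
    False := by
  have hε0 : 0 ≤ ε := (abs_nonneg _).trans (happ m le_rfl).choose_spec
  have happ' : ∀ k : ℕ, ∃ z : ℤ, k ≤ m →
      |p.eval (k : ℝ) - (if m ≤ k then 1 else 0) / 2 - z| ≤ ε := by
    intro k
    by_cases hk : k ≤ m
    · obtain ⟨z, hz⟩ := happ k hk
      exact ⟨z, fun _ => hz⟩
    · exact ⟨0, fun h => absurd h hk⟩
  choose z hz using happ'
  set s := m - t with hs
  have h0 := hann (p.comp (X + C (s : ℝ))) (by
    rw [natDegree_comp, natDegree_X_add_C, mul_one])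
  simp only [eval_comp, eval_add, eval_X, eval_C] at h0
  set e : ℕ → ℝ := fun k =>
    p.eval ((k : ℝ) + s) - (if m ≤ k + s then 1 else 0) / 2 - z (k + s) with he
  have hhalf : ∑ k ∈ range (t + 1), (a k : ℝ) * ((if m ≤ k + s then 1 else 0) / 2) = a t / 2 := by
    rw [sum_range_succ, sum_eq_zero]
    · rw [if_pos (by omega)]; ring
    · intro k hk
      rw [if_neg (by have := mem_range.1 hk; omega)]; simp
  have hsum : ((a t + 2 * ∑ k ∈ range (t + 1), a k * z (k + s) : ℤ) : ℝ) =
      -(2 * ∑ k ∈ range (t + 1), (a k : ℝ) * e k) := by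
    have : ∑ k ∈ range (t + 1), (a k : ℝ) * e k = 0 - a t / 2 -
        ∑ k ∈ range (t + 1), (a k : ℝ) * z (k + s) := by
      rw [← h0, ← hhalf, ← sum_sub_distrib, ← sum_sub_distrib]
      exact sum_congr rfl fun k _ => by simp only [he]; ring
    rw [this]
    push_cast
    ring
  have hbound : |∑ k ∈ range (t + 1), (a k : ℝ) * e k| ≤ (m + 1) * ε := by
    calc |∑ k ∈ range (t + 1), (a k : ℝ) * e k|
        ≤ ∑ k ∈ range (t + 1), |(a k : ℝ) * e k| := abs_sum_le_sum_abs _ _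
      _ ≤ ∑ _k ∈ range (t + 1), ε := by
        refine sum_le_sum fun k hk => ?_
        have hk := mem_range.1 hk
        have h1 : |(a k : ℝ)| ≤ 1 := by exact_mod_cast ha k
        have h2 : |e k| ≤ ε := by simpa [he] using hz (k + s) (by omega)
        rw [abs_mul]
        calc |(a k : ℝ)| * |e k| ≤ 1 * ε := mul_le_mul h1 h2 (abs_nonneg _) zero_le_one
          _ = ε := one_mul _
      _ = (t + 1) * ε := by simp
      _ ≤ (m + 1) * ε := by
        have : (t : ℝ) ≤ m := by exact_mod_cast htm
        gcongr
  have hlt : |((a t + 2 * ∑ k ∈ range (t + 1), a k * z (k + s) : ℤ) : ℝ)| < 1 := by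
    rw [hsum, abs_neg, abs_mul, abs_two]
    linarith
  have hz0 : a t + 2 * ∑ k ∈ range (t + 1), a k * z (k + s) = 0 := by
    rw [← Int.abs_lt_one_iff]; exact_mod_cast hlt
  obtain ⟨r, hr⟩ := hodd
  omega

lemma exists_int_abs_sub_le_of_norm_le {y ε : ℝ} (h : ‖(y : 𝕋)‖ ≤ ε) : ∃ z : ℤ, |y - z| ≤ ε :=
  ⟨round y, by rwa [UnitAddCircle.norm_eq] at h⟩

/-- The counting condition of the pigeonhole argument. -/
lemma pow_lt_two_pow_of_lt_sqrt {n d N : ℕ} (hn : 2 ≤ n) (hd : 1 ≤ d) (hNn : N ≤ n)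
    (hnN : n ≤ 2 * N) (h : (d : ℝ) < 1 / 5 * Real.sqrt ((n : ℝ) / Real.log n)) :
    (N ^ (d + 2)) ^ (d + 1) < 2 ^ N := by
  have hn1 : (1 : ℝ) < n := by exact_mod_cast hn
  have hlog : 0 < Real.log n := Real.log_pos hn1
  have hd1 : (1 : ℝ) ≤ d := by exact_mod_cast hd
  have hnN' : (n : ℝ) ≤ 2 * N := by exact_mod_cast hnN
  have hsq : (d : ℝ) ^ 2 * 25 < n / Real.log n := by
    have h5 : (d : ℝ) * 5 < Real.sqrt (n / Real.log n) := by linarith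
    have := (Real.lt_sqrt (by positivity)).1 h5
    linarith
  rw [lt_div_iff₀ hlog] at hsq
  have hl2 := Real.log_two_gt_d9
  have key : ((d + 2) * (d + 1) : ℝ) * Real.log n < N * Real.log 2 := by
    have h1 : ((d + 2) * (d + 1) : ℝ) ≤ 6 * d ^ 2 := by nlinarith
    have h2 := mul_le_mul_of_nonneg_right h1 hlog.le
    nlinarith
  have hreal : ((n : ℝ) ^ (d + 2)) ^ (d + 1) < 2 ^ N := by
    rw [← Real.log_lt_log_iff (by positivity) (by positivity)]
    simp only [Real.log_pow]
    push_cast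
    linarith
  have hnat : (n ^ (d + 2)) ^ (d + 1) < 2 ^ N := by exact_mod_cast hreal
  exact lt_of_le_of_lt (by gcongr) hnat

/-- any symmetric torus polynomial of degree at most `d` that
`1/(20n)`-approximates MAJORITY on `n` bits satisfies `d ≥ c·√(n/log n)`. -/
theorem stmt_9 : ∃ c : ℝ, 0 < c ∧ ∀ n d : ℕ, 2 ≤ n →
    ∀ P : (Fin n → Bool) → 𝕋, IsSymTorusPoly d P → Approx P maj (1 / (20 * n)) →
    c * Real.sqrt ((n : ℝ) / Real.log n) ≤ d := by
  refine ⟨1 / 5, by norm_num, fun n d hn P ⟨c, hc⟩ happ => ?_⟩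
  by_contra! hlt
  set m := (n + 1) / 2 with hm
  set p : Polynomial ℝ := ∑ j ∈ range (d + 1), Polynomial.C (c j) * Polynomial.X ^ j with hp
  have hdeg : p.natDegree ≤ d := by
    refine Polynomial.natDegree_sum_le_of_forall_le _ _ fun j hj => ?_
    exact (Polynomial.natDegree_C_mul_X_pow_le _ _).trans (Nat.lt_succ_iff.1 (mem_range.1 hj))
  have happ' : ∀ k ≤ m, ∃ z : ℤ,
      |p.eval (k : ℝ) - (if m ≤ k then 1 else 0) / 2 - z| ≤ 1 / (20 * n) := by
    intro k hk
    obtain ⟨x, hx⟩ := exists_wt_eq (n := n) (k := k) (by omega)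
    apply exists_int_abs_sub_le_of_norm_le
    have h := happ x
    have hiff : n ≤ 2 * k ↔ m ≤ k := by omega
    rw [hc x, hx] at h
    simpa [maj, hx, hiff, hp, Polynomial.eval_finsetSum] using h
  have hε : 2 * ((m : ℝ) + 1) * (1 / (20 * n)) < 1 := by
    have hmn : (m : ℝ) ≤ n := by exact_mod_cast (by omega : m ≤ n)
    have hn' : (2 : ℝ) ≤ n := by exact_mod_cast hn
    rw [mul_one_div, div_lt_one (by positivity)]
    linarith
  rcases Nat.eq_zero_or_pos d with rfl | hd
  · refine false_of_annihilating (t := 1) (by omega) (fun k => if k = 0 then -1 else 1) ?_ ?_ ?_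
      hε happ'
    · intro k
      split_ifs <;> simp
    · simp
    · intro q hq
      rw [Polynomial.eq_C_of_natDegree_le_zero (hq.trans hdeg)]
      simp [sum_range_succ]
  · obtain ⟨a, t, ht, ha, hodd, hann⟩ := exists_sign_vector_annihilating (m + 1) d (by omega)
      (pow_lt_two_pow_of_lt_sqrt hn hd (by omega) (by omega) hlt)
    exact false_of_annihilating (Nat.lt_succ_iff.1 ht) a ha hodd
      (fun q hq => hann q (hq.trans hdeg)) hε happ'
end
end

section
/- There exists a constant C > 0 such that for every integer n ≥ 2, every integer w with 0 ≤ w ≤ n, and every ε ∈ (0, 1/2), there exists a symmetric torus polynomial in n variables of degree at most C·(log(n/ε))^C / ε that ε-approximates Δ_w. -/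
open Finset

noncomputable section

theorem dvd_amplifier_sub_one {p k : ℕ} (hp : p.Prime) {u : ℤ} (h : (p : ℤ) ∣ u) :
    (p : ℤ) ^ k ∣ (1 - u ^ (k * (p - 1))) ^ k - 1 := by
  have hu : (p : ℤ) ^ k ∣ u ^ (k * (p - 1)) := by
    refine (pow_dvd_pow_of_dvd h k).trans (pow_dvd_pow u ?_)
    exact Nat.le_mul_of_pos_right k (Nat.sub_pos_of_lt hp.one_lt)
  have hsub := sub_dvd_pow_sub_pow (1 - u ^ (k * (p - 1))) 1 k
  rw [one_pow] at hsub
  refine dvd_trans ?_ hsub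
  simpa using hu

theorem dvd_amplifier {p k : ℕ} (hp : p.Prime) {u : ℤ} (h : ¬ (p : ℤ) ∣ u) :
    (p : ℤ) ^ k ∣ (1 - u ^ (k * (p - 1))) ^ k := by
  refine pow_dvd_pow_of_dvd ?_ k
  have hcop : IsCoprime u p :=
    ((Nat.prime_iff_prime_int.mp hp).coprime_iff_not_dvd.mpr h).symm
  rw [mul_comm, pow_mul]
  simpa using ((Int.ModEq.pow_card_sub_one_eq_one hp hcop).pow k).dvd

theorem coe_add_intCast (x : ℝ) (z : ℤ) : ((x + z : ℝ) : 𝕋) = x := by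
  rw [AddCircle.coe_add, add_eq_left]
  exact (AddCircle.coe_eq_zero_iff 1).mpr ⟨z, by simp⟩

/-- Modulo one, the amplifier scaled by `m / p ^ k` is the indicator of `p ∣ u` scaled likewise. -/
theorem coe_div_mul_amplifier {p k : ℕ} (hp : p.Prime) (m : ℕ) (u : ℤ) :
    (((m : ℝ) / (p : ℝ) ^ k * (1 - (u : ℝ) ^ (k * (p - 1))) ^ k : ℝ) : 𝕋) =
      ((if (p : ℤ) ∣ u then (m : ℝ) / (p : ℝ) ^ k else 0 : ℝ) : 𝕋) := by
  have hpk : (p : ℝ) ^ k ≠ 0 := pow_ne_zero _ (by exact_mod_cast hp.ne_zero)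
  split_ifs with h
  · obtain ⟨z, hz⟩ := dvd_amplifier_sub_one (k := k) hp h
    have hz' : (1 - (u : ℝ) ^ (k * (p - 1))) ^ k = 1 + (p : ℝ) ^ k * z := by
      have : ((1 - (u : ℝ) ^ (k * (p - 1))) ^ k - 1) = (p : ℝ) ^ k * z := by exact_mod_cast hz
      linarith
    rw [hz', ← coe_add_intCast ((m : ℝ) / (p : ℝ) ^ k) (m * z)]
    congr 1
    push_cast
    field_simp
  · obtain ⟨z, hz⟩ := dvd_amplifier (k := k) hp h
    have hz' : (1 - (u : ℝ) ^ (k * (p - 1))) ^ k = (p : ℝ) ^ k * z := by exact_mod_cast hz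
    rw [hz', ← coe_add_intCast 0 (m * z)]
    congr 1
    push_cast
    field_simp
    ring

theorem card_filter_dvd_le_log {S : Finset ℕ} (hS : ∀ p ∈ S, p.Prime) {u : ℤ} (hu : u ≠ 0)
    {n : ℕ} (hn : u.natAbs ≤ n) : #{p ∈ S | ((p : ℕ) : ℤ) ∣ u} ≤ Nat.log 2 n := by
  have hu' : u.natAbs ≠ 0 := Int.natAbs_ne_zero.mpr hu
  have hsub : {p ∈ S | ((p : ℕ) : ℤ) ∣ u} ⊆ u.natAbs.primeFactors := by
    intro p hp
    rw [Finset.mem_filter] at hp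
    exact Nat.mem_primeFactors.mpr ⟨hS p hp.1, Int.natCast_dvd.mp hp.2, hu'⟩
  refine (Finset.card_le_card hsub).trans ((Nat.le_log_iff_pow_le one_lt_two (by omega)).mpr ?_)
  calc 2 ^ #u.natAbs.primeFactors ≤ ∏ p ∈ u.natAbs.primeFactors, p :=
        Finset.pow_card_le_prod _ _ _ fun p hp => (Nat.prime_of_mem_primeFactors hp).two_le
    _ ≤ u.natAbs := Nat.le_of_dvd (Nat.pos_of_ne_zero hu') (Nat.prod_primeFactors_dvd _)
    _ ≤ n := hn

theorem wt_le {n : ℕ} (x : Fin n → Bool) : wt x ≤ n := by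
  calc wt x ≤ ∑ _i : Fin n, 1 := Finset.sum_le_sum fun i _ => by split_ifs <;> simp
    _ = n := by simp

theorem norm_coe_le_abs (x : ℝ) : ‖(x : 𝕋)‖ ≤ |x| := by
  exact QuotientAddGroup.norm_mk_le_norm

open Polynomial in
theorem isSymTorusPoly_eval {n d : ℕ} (f : ℝ[X]) (hf : f.natDegree ≤ d) :
    IsSymTorusPoly d (fun x : Fin n → Bool => ((f.eval (wt x : ℝ) : ℝ) : 𝕋)) :=
  ⟨f.coeff, fun x => congrArg _ (eval_eq_sum_range' (Nat.lt_succ_of_le hf) (wt x : ℝ))⟩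

open Polynomial in
/-- Averaging amplified indicators of `p ∣ wt x - w` over the primes `p ∈ S`. -/
theorem exists_approx_delta_of_primes {n w N k : ℕ} (hw : w ≤ n) {ε : ℝ} {S : Finset ℕ}
    (hS : ∀ p ∈ S, p.Prime) (hSN : ∀ p ∈ S, p ≤ N) (hS0 : 0 < #S)
    (hlog : (Nat.log 2 n : ℝ) ≤ 2 * ε * #S) (hk : (#S : ℝ) ≤ ε * 2 ^ k) :
    ∃ P : (Fin n → Bool) → 𝕋, IsSymTorusPoly (k ^ 2 * N) P ∧ Approx P (delta w) ε := by
  have hr : (0 : ℝ) < #S := by exact_mod_cast hS0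
  let m : ℕ → ℕ := fun p => ⌊(p : ℝ) ^ k / (2 * #S)⌋₊
  let a : ℕ → ℝ := fun p => (m p : ℝ) / (p : ℝ) ^ k
  have ha0 (p : ℕ) : 0 ≤ a p := by positivity
  have hpk (p) (hp : p ∈ S) : (2 : ℝ) ^ k ≤ (p : ℝ) ^ k := by
    have := (hS p hp).two_le
    gcongr
    exact_mod_cast this
  have ha1 (p) (hp : p ∈ S) : a p ≤ 1 / (2 * #S) := by
    have h2 : (0 : ℝ) < (p : ℝ) ^ k := lt_of_lt_of_le (by positivity) (hpk p hp)
    rw [div_le_iff₀ h2, one_div_mul_eq_div]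
    exact Nat.floor_le (by positivity)
  have ha2 (p) (hp : p ∈ S) : 1 / (2 * #S) - 1 / 2 ^ k ≤ a p := by
    have h2 : (0 : ℝ) < (p : ℝ) ^ k := lt_of_lt_of_le (by positivity) (hpk p hp)
    have h3 : 1 / (2 * (#S : ℝ)) - 1 / (p : ℝ) ^ k ≤ a p := by
      rw [le_div_iff₀ h2, sub_mul, one_div_mul_eq_div, one_div_mul_cancel h2.ne']
      linarith [Nat.lt_floor_add_one ((p : ℝ) ^ k / (2 * #S))]
    have h4 : 1 / (p : ℝ) ^ k ≤ 1 / 2 ^ k := one_div_le_one_div_of_le (by positivity) (hpk p hp)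
    linarith
  let f : ℝ[X] := ∑ p ∈ S, C (a p) * (1 - (X - C (w : ℝ)) ^ (k * (p - 1))) ^ k
  have hdeg : f.natDegree ≤ k ^ 2 * N := by
    refine natDegree_sum_le_of_forall_le _ _ fun p hp => ?_
    have hsub : (1 - (X - C (w : ℝ)) ^ (k * (p - 1))).natDegree ≤ k * N := by
      refine (natDegree_sub_le _ _).trans (max_le (by simp) ?_)
      rw [natDegree_pow, natDegree_X_sub_C, mul_one]
      exact Nat.mul_le_mul_left k ((Nat.sub_le p 1).trans (hSN p hp))
    refine (natDegree_C_mul_le _ _).trans ((natDegree_pow_le_of_le k hsub).trans_eq ?_)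
    ring
  have heval (t : ℕ) : ((f.eval (t : ℝ) : ℝ) : 𝕋) =
      ((∑ p ∈ S with ((p : ℕ) : ℤ) ∣ (t : ℤ) - w, a p : ℝ) : 𝕋) := by
    have hcoe (g : ℕ → ℝ) : ((∑ p ∈ S, g p : ℝ) : 𝕋) = ∑ p ∈ S, ((g p : ℝ) : 𝕋) :=
      map_sum (QuotientAddGroup.mk' (AddSubgroup.zmultiples (1 : ℝ))) g S
    rw [Finset.sum_filter, hcoe, eval_finsetSum, hcoe]
    refine Finset.sum_congr rfl fun p hp => ?_
    have := coe_div_mul_amplifier (k := k) (hS p hp) (m p) ((t : ℤ) - w)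
    push_cast at this
    simpa [a] using this
  refine ⟨_, isSymTorusPoly_eval f hdeg, fun x => ?_⟩
  rw [heval, ← AddCircle.coe_sub]
  refine (norm_coe_le_abs _).trans ?_
  by_cases hx : wt x = w
  · have h1 : ∑ p ∈ S, a p ≤ 1 / 2 := by
      refine (Finset.sum_le_card_nsmul _ _ _ ha1).trans_eq ?_
      rw [nsmul_eq_mul]
      field_simp
    have h2 : 1 / 2 - ε ≤ ∑ p ∈ S, a p := by
      refine le_trans ?_ (Finset.card_nsmul_le_sum _ _ _ ha2)
      have h3 : (#S : ℝ) / 2 ^ k ≤ ε := (div_le_iff₀ (by positivity)).mpr hk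
      have h4 : (#S : ℝ) * (1 / (2 * #S) - 1 / 2 ^ k) = 1 / 2 - #S / 2 ^ k := by field_simp
      rw [nsmul_eq_mul, h4]
      linarith
    simp only [hx, sub_self, dvd_zero, Finset.filter_true, delta, decide_true, if_true]
    rw [abs_le]
    constructor <;> linarith
  · have hu : (wt x : ℤ) - w ≠ 0 := by omega
    have hcard : (#{p ∈ S | ((p : ℕ) : ℤ) ∣ (wt x : ℤ) - w} : ℝ) ≤ Nat.log 2 n := by
      have := wt_le x
      exact_mod_cast card_filter_dvd_le_log hS hu (by omega)
    simp only [delta, hx, decide_false, Bool.false_eq_true, if_false, zero_div, sub_zero]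
    rw [abs_of_nonneg (Finset.sum_nonneg fun p _ => ha0 p)]
    refine (Finset.sum_le_card_nsmul _ _ _ fun p hp => ha1 p (Finset.mem_filter.mp hp).1).trans ?_
    rw [nsmul_eq_mul, mul_one_div, div_le_iff₀ (by positivity)]
    linarith

open Real in
theorem exists_prime_parameters {n : ℕ} (hn : 2 ≤ n) {ε : ℝ} (hε : 0 < ε) (hε2 : ε < 1 / 2) :
    ∃ N k : ℕ, ((k ^ 2 * N : ℕ) : ℝ) ≤ 3024 * log (n / ε) ^ 4 / ε ∧ 1 ≤ log (n / ε) ∧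
      0 < #(Nat.primesLE N) ∧ (Nat.log 2 n : ℝ) ≤ 2 * ε * #(Nat.primesLE N) ∧
      (#(Nat.primesLE N) : ℝ) ≤ ε * 2 ^ k := by
  set Y : ℝ := n / ε with hY
  set L : ℝ := log Y with hL
  have hn' : (2 : ℝ) ≤ n := by exact_mod_cast hn
  have hlog2 : 0.693 < log 2 := lt_trans (by norm_num) log_two_gt_d9
  have hY4 : 4 ≤ Y := by rw [hY, le_div_iff₀ hε]; linarith
  have hY0 : 0 < Y := by linarith
  have hL1 : 1.386 ≤ L := by
    have h4 : log 4 ≤ L := log_le_log (by norm_num) hY4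
    rw [show (4 : ℝ) = 2 ^ 2 by norm_num, log_pow] at h4
    push_cast at h4
    linarith
  have hLY : L ≤ Y := (log_le_sub_one_of_pos hY0).trans (by linarith)
  have hεY : 1 / ε ≤ Y := by rw [hY]; gcongr; linarith
  have hε1 : 2 ≤ 1 / ε := by rw [le_div_iff₀ hε]; linarith
  set Q : ℝ := L ^ 2 * (1 / ε) with hQ
  have hQ1 : 2 ≤ Q := by nlinarith
  have hQY : Q ≤ Y ^ 3 := by
    calc Q ≤ Y ^ 2 * Y := by rw [hQ]; gcongr
      _ = Y ^ 3 := by ring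
  set N : ℕ := ⌈20 * Q⌉₊
  set k : ℕ := ⌈11 * L⌉₊
  have hN1 : 20 * Q ≤ N := Nat.le_ceil _
  have hN2 : (N : ℝ) < 20 * Q + 1 := Nat.ceil_lt_add_one (by linarith)
  have hk1 : 11 * L ≤ k := Nat.le_ceil _
  have hk2 : (k : ℝ) < 11 * L + 1 := Nat.ceil_lt_add_one (by linarith)
  have hY3 : (64 : ℝ) ≤ Y ^ 3 := by
    calc (64 : ℝ) = 4 ^ 3 := by norm_num
      _ ≤ Y ^ 3 := by gcongr
  have hN6 : (N : ℝ) + 1 ≤ Y ^ 6 := by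
    calc (N : ℝ) + 1 ≤ 64 * Y ^ 3 := by linarith
      _ ≤ Y ^ 3 * Y ^ 3 := by gcongr
      _ = Y ^ 6 := by ring
  have hlogN1 : log (N + 1) ≤ 6 * L := by
    have := log_le_log (by positivity) hN6
    rwa [log_pow] at this
  have hlogN : log N ≤ 6 * L := le_trans (log_le_log (by linarith) (by linarith)) hlogN1
  have hlogN0 : 0 < log N := log_pos (by linarith)
  have hpi : (1.9 : ℝ) * (L * (1 / ε)) ≤ #(Nat.primesLE N) := by
    have h := Chebyshev.pi_ge N
    rw [div_le_iff₀ hlogN0, ← Nat.primesLE_card_eq_primeCounting] at h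
    set r : ℝ := (#(Nat.primesLE N) : ℝ)
    have hr0 : 0 ≤ r := Nat.cast_nonneg _
    have h1 : r * log N ≤ r * (6 * L) := by gcongr
    have h2 : 20 * Q * 0.693 ≤ N * log 2 := by gcongr
    have h3 : L * (13.86 * (L * (1 / ε))) ≤ L * (6 * r + 6) := by
      rw [hQ] at h2
      nlinarith
    have h4 := le_of_mul_le_mul_left h3 (by linarith)
    nlinarith
  have hrN : (#(Nat.primesLE N) : ℝ) ≤ N := by
    have hsub : Nat.primesLE N ⊆ Finset.Icc 1 N := fun p hp => by
      rw [Nat.mem_primesLE] at hp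
      exact Finset.mem_Icc.mpr ⟨hp.2.one_le, hp.1⟩
    exact_mod_cast (Finset.card_le_card hsub).trans_eq (by simp)
  refine ⟨N, k, ?_, by linarith, ?_, ?_, ?_⟩
  · push_cast
    calc (k : ℝ) ^ 2 * N ≤ (12 * L) ^ 2 * (21 * Q) := by gcongr <;> linarith
      _ = 3024 * L ^ 4 / ε := by rw [hQ]; ring
  · have : (0 : ℝ) < #(Nat.primesLE N) := lt_of_lt_of_le (by positivity) hpi
    exact_mod_cast this
  · have h1 : (Nat.log 2 n : ℝ) * 0.693 ≤ L := by
      have hpow : ((2 : ℝ) ^ Nat.log 2 n) ≤ Y := by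
        calc ((2 : ℝ) ^ Nat.log 2 n) ≤ n := by exact_mod_cast Nat.pow_log_le_self 2 (by omega)
          _ ≤ Y := by rw [hY, le_div_iff₀ hε]; nlinarith
      have := log_le_log (by positivity) hpow
      rw [log_pow] at this
      exact le_trans (by gcongr) this
    have h2 : 2 * ε * (1.9 * (L * (1 / ε))) = 3.8 * L := by field_simp; norm_num
    have h3 : 2 * ε * (1.9 * (L * (1 / ε))) ≤ 2 * ε * #(Nat.primesLE N) := by gcongr
    linarith
  · have h7 : Y ^ 7 ≤ 2 ^ k := by
      rw [← log_le_log_iff (by positivity) (by positivity), log_pow, log_pow]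
      push_cast
      nlinarith
    have h8 : (N : ℝ) ≤ ε * Y ^ 7 := by
      have h1 : 1 ≤ ε * Y := by rw [div_le_iff₀ hε] at hεY; linarith
      calc (N : ℝ) ≤ 1 * Y ^ 6 := by linarith
        _ ≤ ε * Y * Y ^ 6 := by gcongr
        _ = ε * Y ^ 7 := by ring
    calc (#(Nat.primesLE N) : ℝ) ≤ ε * Y ^ 7 := hrN.trans h8
      _ ≤ ε * 2 ^ k := by gcongr

/-- every delta function `Δ_w` on `n` variables is ε-approximated by a
symmetric torus polynomial of degree at most `C·(log(n/ε))^C / ε`. -/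
theorem stmt_10 : ∃ C : ℝ, 0 < C ∧ ∀ n : ℕ, 2 ≤ n → ∀ w : ℕ, w ≤ n →
    ∀ ε : ℝ, 0 < ε → ε < 1 / 2 →
    ∃ d : ℕ, (d : ℝ) ≤ C * Real.log ((n : ℝ) / ε) ^ C / ε ∧
      ∃ P : (Fin n → Bool) → 𝕋, IsSymTorusPoly d P ∧ Approx P (delta w) ε := by
  refine ⟨3024, by norm_num, fun n hn w hw ε hε hε2 => ?_⟩
  obtain ⟨N, k, hd, hL, hcard, hlog, hk⟩ := exists_prime_parameters hn hε hε2
  refine ⟨k ^ 2 * N, hd.trans ?_, exists_approx_delta_of_primes hw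
    (fun p hp => (Nat.mem_primesLE.mp hp).2) (fun p hp => (Nat.mem_primesLE.mp hp).1)
    hcard hlog hk⟩
  gcongr
  rw [← Real.rpow_natCast]
  exact Real.rpow_le_rpow_of_exponent_le hL (by norm_num)
end
end

section
/- Let f : {0,1}^n → {0,1}, let F be a polynomial in n variables with integer coefficients of degree at most d, let k ≥ e ≥ 1 be integers, and suppose there is a function E : {0,1}^n → ℤ with 0 ≤ E(x) ≤ 2^{k−e} such that F(x) ≡ f(x)·2^k + E(x) (mod 2^{k+e}) for every x ∈ {0,1}^n. Then the torus polynomial P(x) = F(x)/2^{k+1} (mod 1), which has degree at most d, satisfies |P(x) − f(x)/2| ≤ 2^{−e} for all x ∈ {0,1}^n; that is, P 2^{−e}-approximates f. -/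
open Finset

noncomputable section

/-- On the Boolean cube an integer polynomial of total degree at most `d` agrees with a
multilinear polynomial of degree at most `d`. -/
theorem exists_multilinear_eq_eval {n d : ℕ} (F : MvPolynomial (Fin n) ℤ)
    (hdeg : F.totalDegree ≤ d) :
    ∃ a : Finset (Fin n) → ℤ, (∀ S, d < S.card → a S = 0) ∧
      ∀ x : Fin n → Bool, ((MvPolynomial.eval (fun i => if x i then (1 : ℤ) else 0) F : ℤ) : ℝ) =
        ∑ S : Finset (Fin n), (a S : ℝ) * ∏ i ∈ S, bval x i := by
  refine ⟨fun S => ∑ m ∈ F.support with m.support = S, F.coeff m, fun S hS => ?_, fun x => ?_⟩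
  · refine Finset.sum_eq_zero fun m hm => ?_
    obtain ⟨hmF, rfl⟩ := Finset.mem_filter.mp hm
    have hle : m.support.card ≤ m.sum fun _ r => r := by
      rw [Finset.card_eq_sum_ones]
      exact Finset.sum_le_sum fun i hi => Nat.one_le_iff_ne_zero.mpr (Finsupp.mem_support_iff.mp hi)
    have := MvPolynomial.le_totalDegree hmF
    omega
  · rw [MvPolynomial.eval_eq, ← Finset.sum_fiberwise F.support (fun m => m.support), Int.cast_sum]
    refine Finset.sum_congr rfl fun S _ => ?_
    push_cast
    rw [Finset.sum_mul]
    refine Finset.sum_congr rfl fun m hm => ?_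
    obtain ⟨-, rfl⟩ := Finset.mem_filter.mp hm
    congr 1
    refine Finset.prod_congr rfl fun i hi => ?_
    have hi0 := Finsupp.mem_support_iff.mp hi
    cases hx : x i <;> simp [bval, hx, hi0]

/-- if an integer polynomial `F` of degree ≤ d satisfies
`F(x) ≡ f(x)·2^k + E(x) (mod 2^{k+e})` with `0 ≤ E(x) ≤ 2^{k−e}` on the Boolean cube,
then the torus polynomial `P(x) = F(x)/2^{k+1} (mod 1)` has degree at most `d` and
`2^{-e}`-approximates `f`. -/
theorem stmt_11 (n d e k : ℕ) (he : 1 ≤ e) (hek : e ≤ k)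
    (f : (Fin n → Bool) → Bool) (F : MvPolynomial (Fin n) ℤ) (hdeg : F.totalDegree ≤ d)
    (E : (Fin n → Bool) → ℤ) (hE : ∀ x, 0 ≤ E x ∧ E x ≤ 2 ^ (k - e))
    (hF : ∀ x : Fin n → Bool,
      MvPolynomial.eval (fun i => if x i then (1 : ℤ) else 0) F ≡
        (if f x then 1 else 0) * 2 ^ k + E x [ZMOD (2 : ℤ) ^ (k + e)]) :
    IsTorusPoly d (fun x => (((MvPolynomial.eval (fun i => if x i then (1 : ℤ) else 0) F : ℤ)
        / (2 : ℝ) ^ (k + 1) : ℝ) : 𝕋)) ∧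
    Approx (fun x => (((MvPolynomial.eval (fun i => if x i then (1 : ℤ) else 0) F : ℤ)
        / (2 : ℝ) ^ (k + 1) : ℝ) : 𝕋)) f ((2 : ℝ)⁻¹ ^ e) := by
  constructor
  · obtain ⟨a, ha, haF⟩ := exists_multilinear_eq_eval F hdeg
    refine ⟨fun S => a S / 2 ^ (k + 1), fun S hS => by simp [ha S hS], fun x => ?_⟩
    dsimp only
    rw [haF x, Finset.sum_div]
    congr 1
    exact Finset.sum_congr rfl fun S _ => by ring
  · intro x
    dsimp only
    obtain ⟨m, hm⟩ := (hF x).symm.dvd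
    obtain ⟨hE0, hE1⟩ := hE x
    generalize MvPolynomial.eval (fun i => if x i then (1 : ℤ) else 0) F = v at hm ⊢
    obtain ⟨j, rfl⟩ := Nat.exists_eq_add_of_le' he
    obtain ⟨l, rfl⟩ := Nat.exists_eq_add_of_le' hek
    have hE1' : (E x : ℝ) ≤ 2 ^ l := by
      rw [Nat.add_sub_cancel] at hE1
      exact_mod_cast hE1
    have hE0' : (0 : ℝ) ≤ E x := by exact_mod_cast hE0
    have hv : (v : ℝ) = (if f x then 1 else 0) * 2 ^ (l + (j + 1)) + E x
        + 2 ^ (l + (j + 1) + (j + 1)) * m := by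
      have := congrArg (Int.cast : ℤ → ℝ) hm
      push_cast at this
      linarith
    have hdiff : (v : ℝ) / 2 ^ (l + (j + 1) + 1) - (if f x then 1 else 0) / 2
        = E x / 2 ^ (l + (j + 1) + 1) + ((2 ^ j * m : ℤ) : ℝ) := by
      rw [hv]
      push_cast
      field_simp
      ring
    rw [← AddCircle.coe_sub, hdiff, UnitAddCircle.norm_eq]
    refine (round_le _ (2 ^ j * m)).trans ?_
    rw [add_sub_cancel_right, abs_of_nonneg (by positivity), div_le_iff₀ (by positivity)]
    refine hE1'.trans ?_
    have : (2 : ℝ)⁻¹ ^ (j + 1) * 2 ^ (l + (j + 1) + 1) = 2 * 2 ^ l := by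
      rw [inv_pow, pow_succ _ (l + (j + 1)), pow_add _ l]
      field_simp
    rw [this]
    have : (0 : ℝ) < 2 ^ l := by positivity
    linarith
end
end

section
/- For every integer k ≥ 1 there exists a univariate polynomial A_k with integer coefficients of degree 2k−1 such that for every integer m ≥ 2 and every x ∈ ℤ: if x ≡ 0 (mod m), then A_k(x) ≡ 0 (mod m^k); and if x ≡ 1 (mod m), then A_k(x) ≡ 1 (mod m^k). -/
open Polynomial in
/-- There is an integer polynomial of degree less than `2 * k` which is `0` modulo `X ^ k` and
`1` modulo `(X - 1) ^ k`. -/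
theorem exists_natDegree_lt_pow_dvd_and_pow_dvd_sub_one (k : ℕ) (hk : 1 ≤ k) :
    ∃ A : ℤ[X], A.natDegree < 2 * k ∧ X ^ k ∣ A ∧ (X - C 1) ^ k ∣ A - 1 := by
  have hco : IsCoprime ((X : ℤ[X]) ^ k) ((X - C 1) ^ k) :=
    IsCoprime.pow ⟨1, -1, by simp⟩
  obtain ⟨u, v, huv⟩ := hco
  have hmonic : ((X - C (1 : ℤ)) ^ k).Monic := (monic_X_sub_C 1).pow k
  have hdeg : ((X - C (1 : ℤ)) ^ k).natDegree = k := by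
    rw [(monic_X_sub_C 1).natDegree_pow, natDegree_X_sub_C, mul_one]
  have hne : (X - C (1 : ℤ)) ^ k ≠ 1 := by
    intro h
    rw [h, natDegree_one] at hdeg
    omega
  have hlt := natDegree_modByMonic_lt u hmonic hne
  refine ⟨(u %ₘ (X - C 1) ^ k) * X ^ k, ?_, dvd_mul_left _ _, ?_⟩
  · refine natDegree_mul_le.trans_lt ?_
    rw [natDegree_X_pow]
    omega
  · have hdiv := modByMonic_add_div u ((X - C (1 : ℤ)) ^ k)
    exact ⟨-(v + (u /ₘ (X - C 1) ^ k) * X ^ k), by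
      linear_combination X ^ k * hdiv + huv⟩

open Polynomial in
/-- A polynomial which is `0` modulo `X ^ k` and `1` modulo `(X - 1) ^ k` has degree at least
`2 * k - 1`. -/
theorem le_natDegree_of_pow_dvd_of_pow_dvd_sub_one {k : ℕ} (hk : 1 ≤ k) {A : ℤ[X]}
    (h0 : X ^ k ∣ A) (h1 : (X - C 1) ^ k ∣ A - 1) : 2 * k - 1 ≤ A.natDegree := by
  have hd0 : X ^ (k - 1) ∣ derivative A := pow_sub_one_dvd_derivative_of_pow_dvd h0
  have hd1 : (X - C 1) ^ (k - 1) ∣ derivative A := by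
    simpa using pow_sub_one_dvd_derivative_of_pow_dvd h1
  have hco : IsCoprime ((X : ℤ[X]) ^ (k - 1)) ((X - C 1) ^ (k - 1)) :=
    IsCoprime.pow ⟨1, -1, by simp⟩
  have hpos : A.natDegree ≠ 0 := by
    intro h
    obtain ⟨c, rfl⟩ := natDegree_eq_zero.mp h
    have e0 := eval_dvd (x := 0) h0
    have e1 := eval_dvd (x := 1) h1
    have hk' : k ≠ 0 := by omega
    simp [hk'] at e0 e1
    omega
  have hder : derivative A ≠ 0 := fun h => hpos (derivative_eq_zero.mp h)
  have hle := natDegree_le_of_dvd (hco.mul_dvd hd0 hd1) hder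
  rw [((monic_X_pow (k - 1)).natDegree_mul ((monic_X_sub_C 1).pow (k - 1))), natDegree_X_pow,
    (monic_X_sub_C 1).natDegree_pow, natDegree_X_sub_C, mul_one] at hle
  have := natDegree_derivative_lt hpos
  omega


/-- Beigel–Tarui modulus amplification: for every `k ≥ 1` there is an
integer polynomial `A_k` of degree `2k−1` such that for every modulus `m ≥ 2` and every
integer `x`: `x ≡ 0 (mod m)` implies `A_k(x) ≡ 0 (mod m^k)`, and `x ≡ 1 (mod m)` implies
`A_k(x) ≡ 1 (mod m^k)`. -/
theorem stmt_12 (k : ℕ) (hk : 1 ≤ k) :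
    ∃ A : Polynomial ℤ, A.natDegree = 2 * k - 1 ∧
      ∀ m : ℤ, 2 ≤ m → ∀ x : ℤ,
        (x ≡ 0 [ZMOD m] → A.eval x ≡ 0 [ZMOD m ^ k]) ∧
        (x ≡ 1 [ZMOD m] → A.eval x ≡ 1 [ZMOD m ^ k]) := by
  obtain ⟨A, hlt, h0, h1⟩ := exists_natDegree_lt_pow_dvd_and_pow_dvd_sub_one k hk
  have hle := le_natDegree_of_pow_dvd_of_pow_dvd_sub_one hk h0 h1
  refine ⟨A, by omega, fun m _ x => ⟨fun hx => ?_, fun hx => ?_⟩⟩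
  · have e0 := Polynomial.eval_dvd (x := x) h0
    rw [Polynomial.eval_pow, Polynomial.eval_X] at e0
    exact Int.modEq_zero_iff_dvd.mpr
      ((pow_dvd_pow_of_dvd (Int.modEq_zero_iff_dvd.mp hx) k).trans e0)
  · have e1 := Polynomial.eval_dvd (x := x) h1
    simp only [Polynomial.eval_pow, Polynomial.eval_sub, Polynomial.eval_X, Polynomial.eval_C,
      Polynomial.eval_one] at e1
    exact (Int.modEq_iff_dvd.mpr ((pow_dvd_pow_of_dvd hx.symm.dvd k).trans e1)).symm
end

section
/- For every integer n ≥ 1, there is no torus polynomial of degree at most n−1 in n variables that equals Δ_n(x)/2 at every point of {0,1}^n. Equivalently, for every real multilinear polynomial P in n variables of degree at most n−1, there exists x ∈ {0,1}^n such that P(x) is not congruent to Δ_n(x)/2 modulo 1. -/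
open Finset

noncomputable section

theorem prod_bval_indicator {n : ℕ} (S T : Finset (Fin n)) :
    ∏ i ∈ S, bval (fun j => decide (j ∈ T)) i = if S ⊆ T then 1 else 0 := by
  simp only [bval, decide_eq_true_eq, Finset.prod_ite_zero, Finset.prod_const_one,
    Finset.subset_iff]

theorem wt_indicator {n : ℕ} (T : Finset (Fin n)) :
    wt (fun j => decide (j ∈ T)) = T.card := by
  simp [wt]

/-- On the indicator of `T`, a multilinear polynomial is the sum of its coefficients over the
subsets of `T`. -/
theorem sum_mul_prod_bval_indicator {n : ℕ} (c : Finset (Fin n) → ℝ) (T : Finset (Fin n)) :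
    ∑ S : Finset (Fin n), c S * ∏ i ∈ S, bval (fun j => decide (j ∈ T)) i =
      ∑ S ∈ T.powerset, c S := by
  simp only [prod_bval_indicator, mul_ite, mul_one, mul_zero, ← Finset.sum_filter]
  congr 1
  ext S
  simp

/-- The class of `1/2` in `ℝ/ℤ` is nonzero. -/
theorem coe_half_ne_zero : ((1 / 2 : ℝ) : 𝕋) ≠ 0 := by
  rw [Ne, AddCircle.coe_eq_zero_iff]
  rintro ⟨k, hk⟩
  have h : (2 * k : ℝ) = 1 := by
    rw [zsmul_eq_mul] at hk
    linarith
  have h' : 2 * k = 1 := by exact_mod_cast h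
  omega

/-- no torus polynomial of degree at most `n−1` in `n` variables equals
`Δ_n(x)/2` (which is `1/2` at the all-ones input and `0` elsewhere) at every point of the
Boolean cube. -/
theorem stmt_13 (n : ℕ) (hn : 1 ≤ n) (P : (Fin n → Bool) → 𝕋)
    (hP : IsTorusPoly (n - 1) P) :
    ∃ x : Fin n → Bool,
      P x ≠ (((if wt x = n then 1 else 0) / 2 : ℝ) : 𝕋) := by
  obtain ⟨c, hc, hPc⟩ := hP
  by_contra! h
  have key (T : Finset (Fin n)) :
      ∑ S ∈ T.powerset, (c S : 𝕋) = (((if T.card = n then 1 else 0) / 2 : ℝ) : 𝕋) := by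
    rw [← wt_indicator T, ← h, hPc, sum_mul_prod_bval_indicator]
    exact (map_sum (QuotientAddGroup.mk' _) c _).symm
  have hzero (T : Finset (Fin n)) : (c T : 𝕋) = 0 := by
    induction T using Finset.strongInduction with
    | H T ih =>
      by_cases hT : T.card = n
      · rw [hc T (by omega)]
        rfl
      · have hsum : ∑ S ∈ T.powerset, (c S : 𝕋) = (c T : 𝕋) :=
          Finset.sum_eq_single_of_mem T (Finset.mem_powerset_self T) fun S hS hne =>
            ih S ((Finset.mem_powerset.mp hS).ssubset_of_ne hne)
        rw [← hsum, key T]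
        simp [hT]
  have htop := key Finset.univ
  rw [Finset.sum_eq_zero fun S _ => hzero S, if_pos (Finset.card_fin n)] at htop
  exact coe_half_ne_zero htop.symm
end
end
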